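/- arXiv:1804.00391 — 2 statements merged into one kernel-verified Lean document; each statement's English description precedes it below -/
import Mathlib

section
/- Suppose there is a value T ∈ {C_e : e ∈ E} such that T − C0 > pa, ∑_{e: C_e > T} pd/(C_e−C0) < 1, and ∑_{e: C_e > T} pd/(C_e−C0) + ∑_{e: C_e = T} pd/(T−C0) > 1 (type II regime). Then (σd, σa) is a Nash equilibrium of Γ if and only if: the security effort vector ρ induced by σd satisfies ρ_e = (C_e−T)/(C_e−C0) for every e with C_e > T and ρ_e = 0 for every other e; and σa(e) = pd/(C_e−C0) for every e with C_e > T, 0 ≤ σa(e) ≤ pd/(T−C0) for every e with C_e = T with ∑_{e: C_e = T} σa(e) = 1 − ∑_{e: C_e > T} pd/(C_e−C0), σa(e) = 0 for every e with C_e < T, and σa(∅) = 0. -/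
open Finset

noncomputable section

namespace SecGame

variable {E : Type*} [Fintype E] [DecidableEq E]

/-- Usage cost after the attacker–defender interaction. -/
def usageCost (C0 : ℝ) (Ce : E → ℝ) (sd : Finset E) : Option E → ℝ
  | some e => if e ∈ sd then C0 else Ce e
  | none => C0

/-- Defender mixed strategy over subsets of facilities. -/
def IsDefMixed (σd : Finset E → ℝ) : Prop :=
  (∀ sd, 0 ≤ σd sd) ∧ ∑ sd : Finset E, σd sd = 1

/-- Attacker mixed strategy over `E ∪ {∅}`. -/
def IsAtkMixed (σa : Option E → ℝ) : Prop :=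
  (∀ sa, 0 ≤ σa sa) ∧ ∑ sa : Option E, σa sa = 1

/-- Defender expected utility. -/
def Ud (C0 : ℝ) (Ce : E → ℝ) (pd : ℝ) (σd : Finset E → ℝ) (σa : Option E → ℝ) : ℝ :=
  ∑ sd : Finset E, ∑ sa : Option E,
    σd sd * σa sa * (-(usageCost C0 Ce sd sa) - pd * (sd.card : ℝ))

/-- Attacker expected utility. -/
def Ua (C0 : ℝ) (Ce : E → ℝ) (pa : ℝ) (σd : Finset E → ℝ) (σa : Option E → ℝ) : ℝ :=
  ∑ sd : Finset E, ∑ sa : Option E,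
    σd sd * σa sa * (usageCost C0 Ce sd sa - pa * (if sa = none then 0 else 1))

/-- Security effort vector induced by a defender mixed strategy. -/
def effort (σd : Finset E → ℝ) (e : E) : ℝ :=
  ∑ sd ∈ Finset.univ.filter (fun sd => e ∈ sd), σd sd

/-- Nash equilibrium of the normal form game Γ. -/
def IsNE (C0 : ℝ) (Ce : E → ℝ) (pa pd : ℝ) (σd : Finset E → ℝ) (σa : Option E → ℝ) : Prop :=
  IsDefMixed σd ∧ IsAtkMixed σa ∧
  (∀ σd', IsDefMixed σd' → Ud C0 Ce pd σd' σa ≤ Ud C0 Ce pd σd σa) ∧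
  (∀ σa', IsAtkMixed σa' → Ua C0 Ce pa σd σa' ≤ Ua C0 Ce pa σd σa)

/-- Security effort vectors in the unit box `[0,1]^E`. -/
def InBox (ρ : E → ℝ) : Prop := ∀ e, 0 ≤ ρ e ∧ ρ e ≤ 1

/-- Defender expected utility as a function of the security effort vector. -/
def UdRho (C0 : ℝ) (Ce : E → ℝ) (pd : ℝ) (ρ : E → ℝ) (σa : Option E → ℝ) : ℝ :=
  -(∑ e : E, (ρ e * ((C0 - Ce e) * σa (some e) + pd) + Ce e * σa (some e))) - C0 * σa none

/-- Attacker expected utility as a function of the security effort vector. -/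
def UaRho (C0 : ℝ) (Ce : E → ℝ) (pa : ℝ) (ρ : E → ℝ) (σa : Option E → ℝ) : ℝ :=
  (∑ e : E, (ρ e * (C0 - Ce e) * σa (some e) + Ce e * σa (some e))) + C0 * σa none
    - pa * ∑ e : E, σa (some e)

/-- Threshold security effort for a vulnerable facility. -/
def rhoHat (C0 : ℝ) (Ce : E → ℝ) (pa : ℝ) (e : E) : ℝ := (Ce e - pa - C0) / (Ce e - C0)

/-- Subgame perfect equilibrium of the sequential game Γ̃. -/
def IsSPE (C0 : ℝ) (Ce : E → ℝ) (pa pd : ℝ) (ρstar : E → ℝ)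
    (σastar : (E → ℝ) → Option E → ℝ) : Prop :=
  InBox ρstar ∧
  (∀ ρ, InBox ρ → IsAtkMixed (σastar ρ) ∧
    ∀ σa, IsAtkMixed σa → UaRho C0 Ce pa ρ σa ≤ UaRho C0 Ce pa ρ (σastar ρ)) ∧
  (∀ ρ, InBox ρ → UdRho C0 Ce pd ρ (σastar ρ) ≤ UdRho C0 Ce pd ρstar (σastar ρstar))

/-- Marginal gain to the defender from securing `e`. -/
def defGain (C0 : ℝ) (Ce : E → ℝ) (pd : ℝ) (σa : Option E → ℝ) (e : E) : ℝ :=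
  (Ce e - C0) * σa (some e) - pd

/-- Expected payoff of a pure attacker strategy against the security effort `ρ`. -/
def atkPayoff (C0 : ℝ) (Ce : E → ℝ) (pa : ℝ) (ρ : E → ℝ) : Option E → ℝ
  | some e => Ce e - ρ e * (Ce e - C0) - pa
  | none => C0

lemma usageCost_some {F : Type*} [DecidableEq F] (C0 : ℝ) (Ce : F → ℝ) (sd : Finset F) (e : F) :
    usageCost C0 Ce sd (some e) = Ce e - (if e ∈ sd then 1 else 0) * (Ce e - C0) := by
  simp only [usageCost]
  split_ifs <;> ring

lemma effort_eq_sum (σd : Finset E → ℝ) (e : E) :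
    effort σd e = ∑ sd, σd sd * (if e ∈ sd then 1 else 0) := by
  simp [effort, Finset.sum_filter]

lemma effort_nonneg {σd : Finset E → ℝ} (h : IsDefMixed σd) (e : E) : 0 ≤ effort σd e :=
  Finset.sum_nonneg fun sd _ => h.1 sd

lemma effort_le_one {σd : Finset E → ℝ} (h : IsDefMixed σd) (e : E) : effort σd e ≤ 1 :=
  h.2 ▸ Finset.sum_le_sum_of_subset_of_nonneg (Finset.filter_subset _ _) fun sd _ _ => h.1 sd

lemma Ud_eq (C0 : ℝ) (Ce : E → ℝ) (pd : ℝ) {σd : Finset E → ℝ} {σa : Option E → ℝ}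
    (hd : IsDefMixed σd) (ha : IsAtkMixed σa) :
    Ud C0 Ce pd σd σa = ∑ e, effort σd e * defGain C0 Ce pd σa e
      - (∑ e, Ce e * σa (some e) + C0 * σa none) := by
  have hsum := ha.2
  rw [Fintype.sum_option] at hsum
  have inner : ∀ sd : Finset E,
      ∑ sa : Option E, σd sd * σa sa * (-(usageCost C0 Ce sd sa) - pd * (sd.card : ℝ))
        = ∑ e, σd sd * (if e ∈ sd then 1 else 0) * defGain C0 Ce pd σa e
          - σd sd * (∑ e, Ce e * σa (some e) + C0 * σa none) := by
    intro sd
    have hcard : (sd.card : ℝ) = ∑ e, if e ∈ sd then (1 : ℝ) else 0 := by simp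
    have hsplit : ∀ sa : Option E,
        σd sd * σa sa * (-(usageCost C0 Ce sd sa) - pd * (sd.card : ℝ))
          = σd sd * (-(σa sa * usageCost C0 Ce sd sa) - pd * (sd.card : ℝ) * σa sa) := by
      intro sa; ring
    have hgain : ∀ e, σd sd * (if e ∈ sd then 1 else 0) * defGain C0 Ce pd σa e
        = σd sd * (Ce e * σa (some e) - σa (some e) * usageCost C0 Ce sd (some e)
          - pd * if e ∈ sd then 1 else 0) := by
      intro e; rw [usageCost_some, defGain]; ring
    simp_rw [hsplit, hgain, ← Finset.mul_sum, Finset.sum_sub_distrib, ← Finset.mul_sum,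
      ha.2, ← hcard, Finset.sum_neg_distrib, Fintype.sum_option]
    simp only [usageCost]
    ring
  simp_rw [Ud, inner, Finset.sum_sub_distrib, ← Finset.sum_mul, hd.2, one_mul]
  rw [Finset.sum_comm]
  simp_rw [effort_eq_sum, Finset.sum_mul]

lemma Ua_eq (C0 : ℝ) (Ce : E → ℝ) (pa : ℝ) {σd : Finset E → ℝ} (σa : Option E → ℝ)
    (hd : IsDefMixed σd) :
    Ua C0 Ce pa σd σa = ∑ sa, σa sa * atkPayoff C0 Ce pa (effort σd) sa := by
  rw [Ua, Finset.sum_comm]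
  refine Finset.sum_congr rfl fun sa _ => ?_
  have hsplit : ∀ c : ℝ, c = c * ∑ sd, σd sd := by simp [hd.2]
  cases sa with
  | none =>
    simp only [atkPayoff, usageCost, if_true, mul_zero, sub_zero]
    rw [hsplit (σa none * C0), Finset.mul_sum]
    exact Finset.sum_congr rfl fun sd _ => by ring
  | some e =>
    have hexp : σa (some e) * atkPayoff C0 Ce pa (effort σd) (some e)
        = σa (some e) * (Ce e - pa) - σa (some e) * (Ce e - C0) * effort σd e := by
      simp only [atkPayoff]; ring
    rw [hexp, hsplit (σa (some e) * (Ce e - pa)), effort_eq_sum, Finset.mul_sum,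
      Finset.mul_sum, ← Finset.sum_sub_distrib]
    refine Finset.sum_congr rfl fun sd _ => ?_
    rw [usageCost_some, if_neg (Option.some_ne_none e)]
    ring

lemma isDefMixed_single (s : Finset E) : IsDefMixed (Pi.single s (1 : ℝ)) := by
  refine ⟨fun sd => ?_, by simp⟩
  by_cases h : sd = s <;> simp [h]

lemma isAtkMixed_single (a : Option E) : IsAtkMixed (Pi.single a (1 : ℝ)) := by
  refine ⟨fun sa => ?_, by simp⟩
  by_cases h : sa = a <;> simp [h]

lemma effort_single (s : Finset E) (e : E) :
    effort (Pi.single s (1 : ℝ)) e = if e ∈ s then 1 else 0 := by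
  simp only [effort_eq_sum, Pi.single_apply, ite_mul, one_mul, zero_mul, Finset.sum_ite_eq',
    Finset.mem_univ, if_true]

/-- At a defender best response each facility's effort maximizes its contribution. -/
lemma effort_mul_defGain {C0 : ℝ} {Ce : E → ℝ} {pd : ℝ} {σd : Finset E → ℝ}
    {σa : Option E → ℝ} (hd : IsDefMixed σd) (ha : IsAtkMixed σa)
    (hbest : ∀ σd', IsDefMixed σd' → Ud C0 Ce pd σd' σa ≤ Ud C0 Ce pd σd σa) (e : E) :
    effort σd e * defGain C0 Ce pd σa e = max (defGain C0 Ce pd σa e) 0 := by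
  set w := defGain C0 Ce pd σa with hw
  have hpt : ∀ e ∈ Finset.univ, effort σd e * w e ≤ max (w e) 0 := by
    intro e _
    have h0 := effort_nonneg hd e
    have h1 := effort_le_one hd e
    rcases le_total (w e) 0 with h | h
    · rw [max_eq_right h]; exact mul_nonpos_of_nonneg_of_nonpos h0 h
    · rw [max_eq_left h]; exact mul_le_of_le_one_left h h1
  have hcmp := hbest _ (isDefMixed_single (Finset.univ.filter fun e => 0 < w e))
  rw [Ud_eq C0 Ce pd (isDefMixed_single _) ha, Ud_eq C0 Ce pd hd ha] at hcmp
  have hpure : ∑ e, effort (Pi.single (Finset.univ.filter fun e => 0 < w e) (1 : ℝ)) e * w e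
      = ∑ e, max (w e) 0 := by
    refine Finset.sum_congr rfl fun e _ => ?_
    rw [effort_single]
    by_cases h : 0 < w e
    · simp [h, h.le]
    · simp [h, not_lt.mp h]
  rw [← hw, hpure] at hcmp
  exact (Finset.sum_eq_sum_iff_of_le hpt).mp
    (le_antisymm (Finset.sum_le_sum hpt) (by linarith)) e (Finset.mem_univ e)

lemma atkPayoff_le {C0 : ℝ} {Ce : E → ℝ} {pa : ℝ} {σd : Finset E → ℝ} {σa : Option E → ℝ}
    (hd : IsDefMixed σd)
    (hbest : ∀ σa', IsAtkMixed σa' → Ua C0 Ce pa σd σa' ≤ Ua C0 Ce pa σd σa) (a : Option E) :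
    atkPayoff C0 Ce pa (effort σd) a ≤ Ua C0 Ce pa σd σa := by
  have h := hbest _ (isAtkMixed_single a)
  rw [Ua_eq C0 Ce pa _ hd] at h
  simpa [Pi.single_apply] using h

/-- Every pure strategy in the support of an attacker best response is optimal. -/
lemma atkPayoff_eq_of_pos {C0 : ℝ} {Ce : E → ℝ} {pa : ℝ} {σd : Finset E → ℝ}
    {σa : Option E → ℝ} (hd : IsDefMixed σd) (ha : IsAtkMixed σa)
    (hbest : ∀ σa', IsAtkMixed σa' → Ua C0 Ce pa σd σa' ≤ Ua C0 Ce pa σd σa) {a : Option E}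
    (hpos : 0 < σa a) :
    atkPayoff C0 Ce pa (effort σd) a = Ua C0 Ce pa σd σa := by
  have hpt : ∀ b ∈ Finset.univ, σa b * atkPayoff C0 Ce pa (effort σd) b
      ≤ σa b * Ua C0 Ce pa σd σa :=
    fun b _ => mul_le_mul_of_nonneg_left (atkPayoff_le hd hbest b) (ha.1 b)
  have hsum : ∑ b, σa b * atkPayoff C0 Ce pa (effort σd) b = ∑ b, σa b * Ua C0 Ce pa σd σa := by
    rw [← Finset.sum_mul, ha.2, one_mul, Ua_eq C0 Ce pa σa hd]
  exact mul_left_cancel₀ hpos.ne'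
    ((Finset.sum_eq_sum_iff_of_le hpt).mp hsum a (Finset.mem_univ a))

/-- Splitting a sum over facilities according to the position of `Ce` relative to `T`. -/
lemma sum_eq_sum_filter_trichotomy {F : Type*} [Fintype F] (Ce : F → ℝ) (T : ℝ) (f : F → ℝ) :
    ∑ e, f e = ∑ e ∈ Finset.univ.filter (fun e => T < Ce e), f e
      + ∑ e ∈ Finset.univ.filter (fun e => Ce e = T), f e
      + ∑ e ∈ Finset.univ.filter (fun e => Ce e < T), f e := by
  simp_rw [Finset.sum_filter, ← Finset.sum_add_distrib]
  refine Finset.sum_congr rfl fun e _ => ?_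
  rcases lt_trichotomy (Ce e) T with h | h | h
  · simp [h, h.ne, h.not_gt]
  · simp [h]
  · simp [h, h.ne', h.not_gt]

/-- **Theorem 1, type II regimes (relatively high defense cost).**
Suppose there is a value `T ∈ {C_e : e ∈ E}` with `T − C0 > pa`,
`∑_{C_e > T} pd/(C_e−C0) < 1` and `∑_{C_e > T} pd/(C_e−C0) + ∑_{C_e = T} pd/(T−C0) > 1`.
Then `(σd,σa)` is a Nash equilibrium of Γ iff the induced effort is `(C_e−T)/(C_e−C0)`
on facilities with `C_e > T` and `0` elsewhere, and the attacker targets facilities with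
`C_e > T` with threshold probability `pd/(C_e−C0)`, splits the remaining probability
(total attack probability `1`, so `σa(∅)=0`) among facilities with `C_e = T`, each at most
`pd/(T−C0)`, and targets no facility with `C_e < T`. -/
theorem NE_characterization_typeII {E : Type*} [Fintype E] [DecidableEq E] [Nonempty E]
    (C0 : ℝ) (Ce : E → ℝ) (pa pd : ℝ) (hpa : 0 < pa) (hpd : 0 < pd)
    (T : ℝ) (hT : ∃ e : E, Ce e = T)
    (hvul : pa < T - C0)
    (hlt : ∑ e ∈ Finset.univ.filter (fun e => T < Ce e), pd / (Ce e - C0) < 1)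
    (hgt : 1 < (∑ e ∈ Finset.univ.filter (fun e => T < Ce e), pd / (Ce e - C0))
      + ∑ e ∈ Finset.univ.filter (fun e => Ce e = T), pd / (T - C0))
    (σd : Finset E → ℝ) (σa : Option E → ℝ) :
    IsNE C0 Ce pa pd σd σa ↔
      (IsDefMixed σd ∧ IsAtkMixed σa ∧
       (∀ e : E, T < Ce e → effort σd e = (Ce e - T) / (Ce e - C0)) ∧
       (∀ e : E, ¬ T < Ce e → effort σd e = 0) ∧
       (∀ e : E, T < Ce e → σa (some e) = pd / (Ce e - C0)) ∧
       (∀ e : E, Ce e = T → 0 ≤ σa (some e) ∧ σa (some e) ≤ pd / (T - C0)) ∧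
       (∑ e ∈ Finset.univ.filter (fun e => Ce e = T), σa (some e)
         = 1 - ∑ e ∈ Finset.univ.filter (fun e => T < Ce e), pd / (Ce e - C0)) ∧
       (∀ e : E, Ce e < T → σa (some e) = 0) ∧
       σa none = 0) := by
  have hTC : 0 < T - C0 := hpa.trans hvul
  constructor
  · rintro ⟨hd, ha, hdbest, habest⟩
    have hle := atkPayoff_le hd habest
    have heq := fun {a} => atkPayoff_eq_of_pos (a := a) hd ha habest
    have hbr := effort_mul_defGain hd ha hdbest
    set M := Ua C0 Ce pa σd σa with hM
    have hρ0 := effort_nonneg hd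
    have htot := ha.2
    rw [Fintype.sum_option, sum_eq_sum_filter_trichotomy Ce T] at htot
    have hLT : 0 ≤ ∑ e ∈ Finset.univ.filter (fun e => Ce e < T), σa (some e) :=
      Finset.sum_nonneg fun e _ => ha.1 _
    have hσ_ge : ∀ e, 0 < effort σd e → pd ≤ (Ce e - C0) * σa (some e) := by
      intro e he
      by_contra! hlt'
      have hw : defGain C0 Ce pd σa e < 0 := by unfold defGain; linarith
      have := hbr e
      rw [max_eq_right hw.le] at this
      exact (mul_neg_of_pos_of_neg he hw).ne this
    have hρ1 : ∀ e, pd < (Ce e - C0) * σa (some e) → effort σd e = 1 := by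
      intro e he
      have hw : 0 < defGain C0 Ce pd σa e := by unfold defGain; linarith
      have := hbr e
      rw [max_eq_left hw.le] at this
      exact (mul_eq_right₀ hw.ne').mp this
    have hover : ¬ ∀ e, T ≤ Ce e → 0 < effort σd e := by
      intro h
      have h1 : ∑ e ∈ Finset.univ.filter (fun e => T < Ce e), pd / (Ce e - C0)
          ≤ ∑ e ∈ Finset.univ.filter (fun e => T < Ce e), σa (some e) := by
        refine Finset.sum_le_sum fun e he => ?_
        have he' : T < Ce e := by simpa using he
        rw [div_le_iff₀ (by linarith), mul_comm]
        exact hσ_ge e (h e he'.le)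
      have h2 : ∑ e ∈ Finset.univ.filter (fun e => Ce e = T), pd / (T - C0)
          ≤ ∑ e ∈ Finset.univ.filter (fun e => Ce e = T), σa (some e) := by
        refine Finset.sum_le_sum fun e he => ?_
        have he' : Ce e = T := by simpa using he
        rw [div_le_iff₀ hTC, mul_comm, ← he']
        exact hσ_ge e (h e he'.ge)
      have := ha.1 none
      linarith
    have hMge : T - pa ≤ M := by
      by_contra! hlt'
      refine hover fun e he => (hρ0 e).lt_of_ne fun h => ?_
      have := hle (some e)
      simp only [atkPayoff, ← h] at this
      linarith
    have hnone : σa none = 0 := by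
      by_contra hne
      have : C0 = M := heq ((ha.1 none).lt_of_ne' hne)
      linarith
    have hσ_le : ∀ e, (Ce e - C0) * σa (some e) ≤ pd := by
      intro e
      by_contra! h
      have hz : σa (some e) = 0 := by
        by_contra hne
        have := heq ((ha.1 (some e)).lt_of_ne' hne)
        simp only [atkPayoff, hρ1 e h] at this
        linarith
      rw [hz] at h
      linarith
    have hρC : ∀ e, 0 < effort σd e → 0 < σa (some e) ∧ 0 < Ce e - C0 := by
      intro e he
      have h := hpd.trans_le (hσ_ge e he)
      have hs : 0 < σa (some e) := (ha.1 _).lt_of_ne' fun h0 => by simp [h0] at h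
      exact ⟨hs, pos_of_mul_pos_left h hs.le⟩
    have hnonneg : ∀ e, 0 ≤ effort σd e * (Ce e - C0) := by
      intro e
      rcases (hρ0 e).eq_or_lt with h | h
      · simp [← h]
      · exact (mul_pos h (hρC e h).2).le
    have hσ_div : ∀ e, T ≤ Ce e → σa (some e) ≤ pd / (Ce e - C0) := by
      intro e he
      rw [le_div_iff₀ (by linarith), mul_comm]
      exact hσ_le e
    have hMeq : M = T - pa := by
      refine le_antisymm ?_ hMge
      by_contra! hgt'
      have hz : ∀ e, Ce e ≤ T → σa (some e) = 0 := by
        intro e he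
        by_contra hne
        have := heq ((ha.1 (some e)).lt_of_ne' hne)
        simp only [atkPayoff] at this
        linarith [hnonneg e]
      have h1 : ∑ e ∈ Finset.univ.filter (fun e => T < Ce e), σa (some e)
          ≤ ∑ e ∈ Finset.univ.filter (fun e => T < Ce e), pd / (Ce e - C0) :=
        Finset.sum_le_sum fun e he => hσ_div e (by simpa using he : T < Ce e).le
      have h2 : ∑ e ∈ Finset.univ.filter (fun e => Ce e = T), σa (some e) = 0 :=
        Finset.sum_eq_zero fun e he => hz e (by simpa using he : Ce e = T).le
      have h3 : ∑ e ∈ Finset.univ.filter (fun e => Ce e < T), σa (some e) = 0 :=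
        Finset.sum_eq_zero fun e he => hz e (by simpa using he : Ce e < T).le
      linarith
    have hρpos : ∀ e, T < Ce e → 0 < effort σd e := by
      intro e he
      refine (hρ0 e).lt_of_ne fun h => ?_
      have := hle (some e)
      simp only [atkPayoff, ← h] at this
      linarith
    have hσ_gt : ∀ e, T < Ce e → σa (some e) = pd / (Ce e - C0) := by
      intro e he
      refine le_antisymm (hσ_div e he.le) ?_
      rw [div_le_iff₀ (by linarith), mul_comm]
      exact hσ_ge e (hρpos e he)
    have hσ_lt : ∀ e, Ce e < T → σa (some e) = 0 := by
      intro e he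
      by_contra hne
      have := heq ((ha.1 (some e)).lt_of_ne' hne)
      simp only [atkPayoff] at this
      linarith [hnonneg e]
    refine ⟨hd, ha, ?_, ?_, hσ_gt, ?_, ?_, hσ_lt, hnone⟩
    · intro e he
      have := heq (hρC e (hρpos e he)).1
      simp only [atkPayoff] at this
      rw [eq_div_iff (by linarith)]
      linarith
    · intro e he
      by_contra hne
      have hpos := (hρ0 e).lt_of_ne' hne
      have := heq (hρC e hpos).1
      simp only [atkPayoff] at this
      linarith [mul_pos hpos (hρC e hpos).2]
    · intro e he
      exact ⟨ha.1 _, he ▸ hσ_div e he.ge⟩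
    · have h1 : ∑ e ∈ Finset.univ.filter (fun e => T < Ce e), σa (some e)
          = ∑ e ∈ Finset.univ.filter (fun e => T < Ce e), pd / (Ce e - C0) :=
        Finset.sum_congr rfl fun e he => hσ_gt e (by simpa using he)
      have h3 : ∑ e ∈ Finset.univ.filter (fun e => Ce e < T), σa (some e) = 0 :=
        Finset.sum_eq_zero fun e he => hσ_lt e (by simpa using he)
      linarith
  · rintro ⟨hd, ha, hρ_gt, hρ_le, hσ_gt, hσ_eq, -, hσ_lt, hnone⟩
    have hgain : ∀ e, defGain C0 Ce pd σa e ≤ 0 := by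
      intro e
      unfold defGain
      rcases lt_trichotomy (Ce e) T with h | h | h
      · rw [hσ_lt e h]; linarith
      · have := (hσ_eq e h).2
        rw [le_div_iff₀ hTC] at this
        rw [h]; linarith
      · rw [hσ_gt e h, mul_div_cancel₀ _ (by linarith)]; linarith
    have hzero : ∀ e, effort σd e * defGain C0 Ce pd σa e = 0 := by
      intro e
      by_cases h : T < Ce e
      · rw [defGain, hσ_gt e h, mul_div_cancel₀ _ (by linarith)]; ring
      · rw [hρ_le e h, zero_mul]
    have hpay_ge : ∀ e, T ≤ Ce e → atkPayoff C0 Ce pa (effort σd) (some e) = T - pa := by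
      intro e he
      simp only [atkPayoff]
      rcases he.eq_or_lt with h | h
      · rw [hρ_le e h.not_lt, ← h]; ring
      · rw [hρ_gt e h, div_mul_cancel₀ _ (by linarith)]; ring
    have hpay_le : ∀ a, atkPayoff C0 Ce pa (effort σd) a ≤ T - pa := by
      rintro (_ | e)
      · simp only [atkPayoff]; linarith
      · rcases le_or_gt T (Ce e) with h | h
        · exact (hpay_ge e h).le
        · simp only [atkPayoff]
          rw [hρ_le e h.not_gt]; linarith
    refine ⟨hd, ha, fun σd' hd' => ?_, fun σa' ha' => ?_⟩
    · rw [Ud_eq C0 Ce pd hd' ha, Ud_eq C0 Ce pd hd ha]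
      refine sub_le_sub_right (Finset.sum_le_sum fun e _ => ?_) _
      rw [hzero e]
      exact mul_nonpos_of_nonneg_of_nonpos (effort_nonneg hd' e) (hgain e)
    · rw [Ua_eq C0 Ce pa _ hd, Ua_eq C0 Ce pa _ hd]
      calc ∑ a, σa' a * atkPayoff C0 Ce pa (effort σd) a
          ≤ ∑ a, σa' a * (T - pa) :=
            Finset.sum_le_sum fun a _ => mul_le_mul_of_nonneg_left (hpay_le a) (ha'.1 a)
        _ = ∑ a, σa a * (T - pa) := by rw [← Finset.sum_mul, ← Finset.sum_mul, ha.2, ha'.2]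
        _ = ∑ a, σa a * atkPayoff C0 Ce pa (effort σd) a := by
            refine Finset.sum_congr rfl fun a _ => ?_
            rcases a with _ | e
            · simp [hnone]
            · rcases le_or_gt T (Ce e) with h | h
              · rw [hpay_ge e h]
              · simp [hσ_lt e h]

end SecGame
end
end

section
/- Assume pa ≠ C_e − C0 for every e ∈ E, and suppose T ∈ {C_e : e ∈ E} satisfies T − C0 > pa, ∑_{e: C_e > T} pd/(C_e−C0) < 1, and ∑_{e: C_e > T} pd/(C_e−C0) + ∑_{e: C_e = T} pd/(T−C0) > 1. Set U_deter := −C0 − pd·∑_{e∈V} ρ̂_e and U_attack := −T − pd·∑_{e: C_e > T} (C_e−T)/(C_e−C0). Then: (i) if U_deter > U_attack, in every SPE of Γ̃ one has ρ*_e = ρ̂_e for every e ∈ V, ρ*_e = 0 for every e ∉ V, and σa*(∅, ρ*) = 1; (ii) if U_attack > U_deter, in every SPE of Γ̃ one has ρ*_e = (C_e−T)/(C_e−C0) for every e with C_e > T, ρ*_e = 0 for every other e, and ∑_{e∈E} σa*(e, ρ*) = 1. -/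
open Finset

noncomputable section

namespace SecGame

variable {E : Type*} [Fintype E] [DecidableEq E]

lemma UaRho_eq_sum (C0 : ℝ) (Ce : E → ℝ) (pa : ℝ) (ρ : E → ℝ) (σa : Option E → ℝ) :
    UaRho C0 Ce pa ρ σa = ∑ a, σa a * atkPayoff C0 Ce pa ρ a := by
  rw [Fintype.sum_option, UaRho, Finset.mul_sum, add_sub_right_comm, ← Finset.sum_sub_distrib,
    add_comm]
  simp only [atkPayoff]
  congr 1
  · ring
  · exact Finset.sum_congr rfl fun e _ => by ring

lemma UdRho_eq (C0 : ℝ) (Ce : E → ℝ) (pa pd : ℝ) (ρ : E → ℝ) (σa : Option E → ℝ) :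
    UdRho C0 Ce pd ρ σa
      = -UaRho C0 Ce pa ρ σa - pa * ∑ e, σa (some e) - pd * ∑ e, ρ e := by
  have h : ∑ e, (ρ e * ((C0 - Ce e) * σa (some e) + pd) + Ce e * σa (some e))
      = ∑ e, (ρ e * (C0 - Ce e) * σa (some e) + Ce e * σa (some e)) + pd * ∑ e, ρ e := by
    rw [Finset.mul_sum, ← Finset.sum_add_distrib]
    exact Finset.sum_congr rfl fun e _ => by ring
  rw [UdRho, UaRho, h]
  ring

/-- `σa` is a best response of the attacker to the effort vector `ρ`. -/
def IsBestResponse (C0 : ℝ) (Ce : E → ℝ) (pa : ℝ) (ρ : E → ℝ) (σa : Option E → ℝ) : Prop :=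
  IsAtkMixed σa ∧ ∀ σa', IsAtkMixed σa' → UaRho C0 Ce pa ρ σa' ≤ UaRho C0 Ce pa ρ σa

section BestResponse

variable {C0 : ℝ} {Ce : E → ℝ} {pa : ℝ} {ρ : E → ℝ} {σa : Option E → ℝ}

lemma IsBestResponse.atkPayoff_le (h : IsBestResponse C0 Ce pa ρ σa) (a : Option E) :
    atkPayoff C0 Ce pa ρ a ≤ UaRho C0 Ce pa ρ σa := by
  have := h.2 (Pi.single a 1) ⟨fun b => by
    by_cases hb : b = a
    · subst hb; simp
    · simp [hb], by simp⟩
  rw [UaRho_eq_sum] at this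
  simpa [Pi.single_apply] using this

lemma IsBestResponse.eq_zero_of_lt (h : IsBestResponse C0 Ce pa ρ σa) {a : Option E}
    (ha : atkPayoff C0 Ce pa ρ a < UaRho C0 Ce pa ρ σa) : σa a = 0 := by
  have hsum : ∑ b, σa b * (UaRho C0 Ce pa ρ σa - atkPayoff C0 Ce pa ρ b) = 0 := by
    simp only [mul_sub, Finset.sum_sub_distrib]
    rw [← Finset.sum_mul, h.1.2, ← UaRho_eq_sum]
    ring
  have hz := (Finset.sum_eq_zero_iff_of_nonneg fun b _ =>
    mul_nonneg (h.1.1 b) (sub_nonneg.2 (h.atkPayoff_le b))).1 hsum a (Finset.mem_univ a)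
  exact (mul_eq_zero.1 hz).resolve_right (sub_pos.2 ha).ne'

lemma IsBestResponse.le_UaRho (h : IsBestResponse C0 Ce pa ρ σa) :
    C0 ≤ UaRho C0 Ce pa ρ σa :=
  h.atkPayoff_le none

lemma IsBestResponse.sum_some_eq_one (h : IsBestResponse C0 Ce pa ρ σa)
    (hM : C0 < UaRho C0 Ce pa ρ σa) : ∑ e, σa (some e) = 1 := by
  have h0 : σa none = 0 := h.eq_zero_of_lt hM
  have h1 := h.1.2
  rw [Fintype.sum_option, h0, zero_add] at h1
  exact h1

lemma IsBestResponse.residual_le (h : IsBestResponse C0 Ce pa ρ σa) (e : E) :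
    Ce e - ρ e * (Ce e - C0) ≤ UaRho C0 Ce pa ρ σa + pa := by
  have := h.atkPayoff_le (some e)
  simp only [atkPayoff] at this
  linarith

lemma IsBestResponse.UaRho_le (h : IsBestResponse C0 Ce pa ρ σa) {M : ℝ}
    (hM : ∀ a, atkPayoff C0 Ce pa ρ a ≤ M) : UaRho C0 Ce pa ρ σa ≤ M := by
  calc UaRho C0 Ce pa ρ σa = ∑ a, σa a * atkPayoff C0 Ce pa ρ a := UaRho_eq_sum ..
    _ ≤ ∑ a, σa a * M :=
      Finset.sum_le_sum fun a _ => mul_le_mul_of_nonneg_left (hM a) (h.1.1 a)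
    _ = M := by rw [← Finset.sum_mul, h.1.2, one_mul]

lemma IsBestResponse.none_eq_one (h : IsBestResponse C0 Ce pa ρ σa)
    (hlt : ∀ e, atkPayoff C0 Ce pa ρ (some e) < C0) : σa none = 1 := by
  have h1 := h.1.2
  rw [Fintype.sum_option, Finset.sum_eq_zero fun e _ =>
    h.eq_zero_of_lt ((hlt e).trans_le h.le_UaRho), add_zero] at h1
  exact h1

end BestResponse

section Effort

variable {C0 : ℝ} {Ce : E → ℝ} {ρ : E → ℝ} {x : ℝ}

lemma div_le_effort {e : E} (he : C0 < Ce e) (hx : Ce e - ρ e * (Ce e - C0) ≤ x) :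
    (Ce e - x) / (Ce e - C0) ≤ ρ e := by
  rw [div_le_iff₀ (sub_pos.2 he)]
  linarith

lemma sum_div_le_sum_effort (hρ : InBox ρ) (hx : ∀ e, Ce e - ρ e * (Ce e - C0) ≤ x)
    {S : Finset E} (hS : ∀ e ∈ S, C0 < Ce e) :
    ∑ e ∈ S, (Ce e - x) / (Ce e - C0) ≤ ∑ e, ρ e :=
  (Finset.sum_le_sum fun e he => div_le_effort (hS e he) (hx e)).trans
    (Finset.sum_le_sum_of_subset_of_nonneg S.subset_univ fun e _ _ => (hρ e).1)

/-- An effort vector that spends no more than the least effort keeping residual costs below `x`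
on the facilities satisfying `p` equals that least effort. -/
lemma effort_eq_of_sum_le {p : E → Prop} [DecidablePred p] (hρ : InBox ρ)
    (hx : ∀ e, Ce e - ρ e * (Ce e - C0) ≤ x) (hp : ∀ e, p e → C0 < Ce e)
    (hsum : ∑ e, ρ e ≤ ∑ e ∈ Finset.univ.filter p, (Ce e - x) / (Ce e - C0)) (e : E) :
    ρ e = if p e then (Ce e - x) / (Ce e - C0) else 0 := by
  have hle : ∀ e ∈ Finset.univ, (if p e then (Ce e - x) / (Ce e - C0) else 0) ≤ ρ e := by
    intro e _
    split_ifs with h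
    · exact div_le_effort (hp e h) (hx e)
    · exact (hρ e).1
  rw [Finset.sum_filter] at hsum
  exact ((Finset.sum_eq_sum_iff_of_le hle).1 ((Finset.sum_le_sum hle).antisymm hsum) e
    (Finset.mem_univ e)).symm

lemma mul_sum_div_sub (pd T x : ℝ) (S : Finset E) :
    pd * ∑ e ∈ S, (Ce e - x) / (Ce e - C0)
      = pd * ∑ e ∈ S, (Ce e - T) / (Ce e - C0) + (T - x) * ∑ e ∈ S, pd / (Ce e - C0) := by
  simp only [Finset.mul_sum, ← Finset.sum_add_distrib]
  exact Finset.sum_congr rfl fun e _ => by ring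

/-- Capping the residual costs at `x ≠ T` is strictly costlier than capping them at `T`. -/
lemma attack_cost_lt {pd T : ℝ} (hpd : 0 < pd) (hT : C0 < T)
    (hlt : ∑ e ∈ Finset.univ.filter (fun e => T < Ce e), pd / (Ce e - C0) < 1)
    (hgt : 1 < (∑ e ∈ Finset.univ.filter (fun e => T < Ce e), pd / (Ce e - C0))
      + ∑ e ∈ Finset.univ.filter (fun e => Ce e = T), pd / (T - C0))
    (hρ : InBox ρ) (hx : ∀ e, Ce e - ρ e * (Ce e - C0) ≤ x) (hne : x ≠ T) :
    T + pd * ∑ e ∈ Finset.univ.filter (fun e => T < Ce e), (Ce e - T) / (Ce e - C0)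
      < x + pd * ∑ e, ρ e := by
  rcases hne.lt_or_gt with h | h
  · have hS : ∀ e ∈ Finset.univ.filter (fun e => T < Ce e) ∪
        Finset.univ.filter (fun e => Ce e = T), C0 < Ce e := by
      intro e he
      simp only [Finset.mem_union, Finset.mem_filter, Finset.mem_univ, true_and] at he
      rcases he with he | he <;> linarith
    have h1 := mul_le_mul_of_nonneg_left (sum_div_le_sum_effort hρ hx hS) hpd.le
    have hdisj : Disjoint (Finset.univ.filter (fun e => T < Ce e))
        (Finset.univ.filter (fun e => Ce e = T)) :=
      Finset.disjoint_filter.2 fun e _ h1 h2 => h1.ne' h2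
    have h2 : ∑ e ∈ Finset.univ.filter (fun e => Ce e = T), (Ce e - T) / (Ce e - C0) = 0 :=
      Finset.sum_eq_zero fun e he => by simp [(Finset.mem_filter.1 he).2]
    have h3 : ∑ e ∈ Finset.univ.filter (fun e => Ce e = T), pd / (Ce e - C0)
        = ∑ e ∈ Finset.univ.filter (fun e => Ce e = T), pd / (T - C0) :=
      Finset.sum_congr rfl fun e he => by rw [(Finset.mem_filter.1 he).2]
    rw [mul_sum_div_sub pd T, Finset.sum_union hdisj, Finset.sum_union hdisj, h2, h3] at h1
    nlinarith
  · have hS : ∀ e ∈ Finset.univ.filter (fun e => T < Ce e), C0 < Ce e :=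
      fun e he => hT.trans (Finset.mem_filter.1 he).2
    have h1 := mul_le_mul_of_nonneg_left (sum_div_le_sum_effort hρ hx hS) hpd.le
    rw [mul_sum_div_sub pd T] at h1
    nlinarith

/-- Non-strict form of `attack_cost_lt`, valid for every cap `x`. -/
lemma attack_cost_le {pd T : ℝ} (hpd : 0 < pd) (hT : C0 < T)
    (hlt : ∑ e ∈ Finset.univ.filter (fun e => T < Ce e), pd / (Ce e - C0) < 1)
    (hgt : 1 < (∑ e ∈ Finset.univ.filter (fun e => T < Ce e), pd / (Ce e - C0))
      + ∑ e ∈ Finset.univ.filter (fun e => Ce e = T), pd / (T - C0))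
    (hρ : InBox ρ) (hx : ∀ e, Ce e - ρ e * (Ce e - C0) ≤ x) :
    T + pd * ∑ e ∈ Finset.univ.filter (fun e => T < Ce e), (Ce e - T) / (Ce e - C0)
      ≤ x + pd * ∑ e, ρ e := by
  by_cases hne : x = T
  · subst hne
    have := mul_le_mul_of_nonneg_left (sum_div_le_sum_effort hρ hx
      (S := Finset.univ.filter fun e => x < Ce e)
      fun e he => hT.trans (Finset.mem_filter.1 he).2) hpd.le
    linarith
  · exact (attack_cost_lt hpd hT hlt hgt hρ hx hne).le

end Effort

lemma inBox_ite {p : E → Prop} [DecidablePred p] {f : E → ℝ}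
    (hf : ∀ e, p e → 0 ≤ f e ∧ f e ≤ 1) : InBox fun e => if p e then f e else 0 := by
  intro e
  dsimp only
  split_ifs with h
  · exact hf e h
  · exact ⟨le_rfl, zero_le_one⟩

section Equilibrium

variable {C0 : ℝ} {Ce : E → ℝ} {pa pd : ℝ} {ρstar : E → ℝ} {σastar : (E → ℝ) → Option E → ℝ}

lemma rhoHat_eq (e : E) : rhoHat C0 Ce pa e = (Ce e - (C0 + pa)) / (Ce e - C0) := by
  rw [rhoHat, sub_sub, add_comm pa]

lemma rhoHat_mem (hpa : 0 < pa) {e : E} (he : C0 < Ce e - pa) :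
    0 ≤ rhoHat C0 Ce pa e ∧ rhoHat C0 Ce pa e < 1 := by
  have h : 0 < Ce e - C0 := by linarith
  exact ⟨div_nonneg (by linarith) h.le, (div_lt_one h).2 (by linarith)⟩

/-- Efforts slightly above the thresholds deter the attacker, so in equilibrium the defender gets
at least the value of threshold deterrence. -/
lemma IsSPE.deter_le (hpa : 0 < pa) (hpd : 0 < pd) (hgen : ∀ e : E, pa ≠ Ce e - C0)
    (h : IsSPE C0 Ce pa pd ρstar σastar) :
    -C0 - pd * ∑ e ∈ Finset.univ.filter (fun e => C0 < Ce e - pa), rhoHat C0 Ce pa e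
      ≤ UdRho C0 Ce pd ρstar (σastar ρstar) := by
  set K := pd * ∑ e ∈ Finset.univ.filter (fun e => C0 < Ce e - pa), (1 - rhoHat C0 Ce pa e)
  have hK : 0 ≤ K := mul_nonneg hpd.le <| Finset.sum_nonneg fun e he =>
    sub_nonneg.2 (rhoHat_mem hpa (Finset.mem_filter.1 he).2).2.le
  refine le_of_forall_pos_sub_le fun ε hε => ?_
  set t := ε / (K + ε)
  have hKε : 0 < K + ε := by linarith
  have ht0 : 0 < t := div_pos hε hKε
  have ht1 : t ≤ 1 := (div_le_one hKε).2 (by linarith)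
  have htK : t * K ≤ ε := by
    have : t * (K + ε) = ε := div_mul_cancel₀ _ hKε.ne'
    nlinarith
  set ρ : E → ℝ := fun e => if C0 < Ce e - pa then
    rhoHat C0 Ce pa e + t * (1 - rhoHat C0 Ce pa e) else 0 with hρdef
  have hρ : InBox ρ := by
    refine inBox_ite fun e he => ?_
    obtain ⟨h0, h1⟩ := rhoHat_mem hpa he
    constructor <;> nlinarith
  have hbr : IsBestResponse C0 Ce pa ρ (σastar ρ) := h.2.1 ρ hρ
  have hnone : ∀ e, atkPayoff C0 Ce pa ρ (some e) < C0 := by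
    intro e
    simp only [atkPayoff, hρdef]
    split_ifs with he
    · have hpos : 0 < Ce e - C0 := by linarith
      have hmul : rhoHat C0 Ce pa e * (Ce e - C0) = Ce e - pa - C0 :=
        div_mul_cancel₀ _ hpos.ne'
      have := mul_pos (mul_pos ht0 (sub_pos.2 (rhoHat_mem hpa he).2)) hpos
      linarith
    · have := (not_lt.1 he).lt_of_ne fun h => hgen e (by linarith)
      linarith
  have hσ := hbr.none_eq_one hnone
  have hsome : ∑ e, σastar ρ (some e) = 0 := by
    have h1 := hbr.1.2
    rw [Fintype.sum_option, hσ] at h1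
    linarith
  have hM : UaRho C0 Ce pa ρ (σastar ρ) = C0 :=
    le_antisymm (hbr.UaRho_le fun a => by
      cases a with
      | none => exact le_rfl
      | some e => exact (hnone e).le) hbr.le_UaRho
  have hsum : pd * ∑ e, ρ e
      = pd * ∑ e ∈ Finset.univ.filter (fun e => C0 < Ce e - pa), rhoHat C0 Ce pa e + t * K := by
    rw [hρdef, ← Finset.sum_filter, Finset.sum_add_distrib, ← Finset.mul_sum]
    ring
  have hle := h.2.2 ρ hρ
  rw [UdRho_eq C0 Ce pa pd ρ, hM, hsome, hsum] at hle
  linarith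

/-- Capping the residual costs at `T` guarantees the defender the value of being attacked. -/
lemma IsSPE.attack_le (hpa : 0 < pa) {T : ℝ} (hT : ∃ e : E, Ce e = T) (hvul : pa < T - C0)
    (h : IsSPE C0 Ce pa pd ρstar σastar) :
    -T - pd * ∑ e ∈ Finset.univ.filter (fun e => T < Ce e), (Ce e - T) / (Ce e - C0)
      ≤ UdRho C0 Ce pd ρstar (σastar ρstar) := by
  set ρ : E → ℝ := fun e => if T < Ce e then (Ce e - T) / (Ce e - C0) else 0 with hρdef
  have hρ : InBox ρ := by
    refine inBox_ite fun e he => ?_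
    have hpos : 0 < Ce e - C0 := by linarith
    exact ⟨div_nonneg (by linarith) hpos.le, (div_le_one hpos).2 (by linarith)⟩
  have hbr : IsBestResponse C0 Ce pa ρ (σastar ρ) := h.2.1 ρ hρ
  have hle : UaRho C0 Ce pa ρ (σastar ρ) ≤ T - pa := by
    refine hbr.UaRho_le fun a => ?_
    cases a with
    | none => simp only [atkPayoff]; linarith
    | some e =>
      simp only [atkPayoff, hρdef]
      split_ifs with he
      · rw [div_mul_cancel₀ _ (by linarith : Ce e - C0 ≠ 0)]
        linarith
      · linarith
  have hM : UaRho C0 Ce pa ρ (σastar ρ) = T - pa := by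
    obtain ⟨e, he⟩ := hT
    refine hle.antisymm ?_
    have := hbr.atkPayoff_le (some e)
    simpa [atkPayoff, hρdef, he] using this
  have hone := hbr.sum_some_eq_one (by linarith)
  have hopt := h.2.2 ρ hρ
  rw [UdRho_eq C0 Ce pa pd ρ, hM, hone, hρdef, ← Finset.sum_filter] at hopt
  linarith

end Equilibrium

/-- **Theorem 2, type II parameters: deterrence versus attack in SPE.**
Assume `pa ≠ C_e − C0` for every `e`, and `T ∈ {C_e}` satisfies `T − C0 > pa`,
`∑_{C_e>T} pd/(C_e−C0) < 1` and `∑_{C_e>T} pd/(C_e−C0) + ∑_{C_e=T} pd/(T−C0) > 1`.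
Let `U_deter = −C0 − pd·∑_{e∈V} ρ̂_e` and
`U_attack = −T − pd·∑_{C_e>T} (C_e−T)/(C_e−C0)`.
(i) If `U_deter > U_attack`, every SPE has `ρ*_e = ρ̂_e` on `V`, `ρ*_e = 0` off `V`, and
full deterrence `σa*(∅,ρ*) = 1`. (ii) If `U_attack > U_deter`, every SPE has
`ρ*_e = (C_e−T)/(C_e−C0)` for `C_e > T`, `ρ*_e = 0` otherwise, and total on-path attack
probability `1`. -/
theorem SPE_deter_or_attack {E : Type*} [Fintype E] [DecidableEq E] [Nonempty E]
    (C0 : ℝ) (Ce : E → ℝ) (pa pd : ℝ) (hpa : 0 < pa) (hpd : 0 < pd)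
    (hgen : ∀ e : E, pa ≠ Ce e - C0)
    (T : ℝ) (hT : ∃ e : E, Ce e = T)
    (hvul : pa < T - C0)
    (hlt : ∑ e ∈ Finset.univ.filter (fun e => T < Ce e), pd / (Ce e - C0) < 1)
    (hgt : 1 < (∑ e ∈ Finset.univ.filter (fun e => T < Ce e), pd / (Ce e - C0))
      + ∑ e ∈ Finset.univ.filter (fun e => Ce e = T), pd / (T - C0)) :
    ((-T - pd * ∑ e ∈ Finset.univ.filter (fun e => T < Ce e), (Ce e - T) / (Ce e - C0)
        < -C0 - pd * ∑ e ∈ Finset.univ.filter (fun e => C0 < Ce e - pa), rhoHat C0 Ce pa e) →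
      ∀ (ρstar : E → ℝ) (σastar : (E → ℝ) → Option E → ℝ),
        IsSPE C0 Ce pa pd ρstar σastar →
          (∀ e : E, C0 < Ce e - pa → ρstar e = rhoHat C0 Ce pa e) ∧
          (∀ e : E, ¬ C0 < Ce e - pa → ρstar e = 0) ∧
          σastar ρstar none = 1) ∧
    ((-C0 - pd * ∑ e ∈ Finset.univ.filter (fun e => C0 < Ce e - pa), rhoHat C0 Ce pa e
        < -T - pd * ∑ e ∈ Finset.univ.filter (fun e => T < Ce e), (Ce e - T) / (Ce e - C0)) →
      ∀ (ρstar : E → ℝ) (σastar : (E → ℝ) → Option E → ℝ),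
        IsSPE C0 Ce pa pd ρstar σastar →
          (∀ e : E, T < Ce e → ρstar e = (Ce e - T) / (Ce e - C0)) ∧
          (∀ e : E, ¬ T < Ce e → ρstar e = 0) ∧
          ∑ e : E, σastar ρstar (some e) = 1) := by
  have hC0T : C0 < T := by linarith
  have hV : ∀ e, C0 < Ce e - pa → C0 < Ce e := fun e he => by linarith
  have hS : ∀ e, T < Ce e → C0 < Ce e := fun e he => hC0T.trans he
  refine ⟨fun hU ρstar σastar h => ?_, fun hU ρstar σastar h => ?_⟩
  · have hρ := h.1
    have hbr : IsBestResponse C0 Ce pa ρstar (σastar ρstar) := h.2.1 ρstar hρ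
    have hval := h.deter_le hpa hpd hgen
    rw [UdRho_eq C0 Ce pa pd] at hval
    have hM : UaRho C0 Ce pa ρstar (σastar ρstar) = C0 := by
      refine (hbr.le_UaRho.eq_of_not_lt fun hM => ?_).symm
      rw [hbr.sum_some_eq_one hM] at hval
      have := attack_cost_le hpd hC0T hlt hgt hρ hbr.residual_le
      linarith
    have hx := hbr.residual_le
    rw [hM] at hval hx
    simp only [rhoHat_eq] at hval ⊢
    have hP : 0 ≤ ∑ e, σastar ρstar (some e) := Finset.sum_nonneg fun e _ => hbr.1.1 _
    have hsum := sum_div_le_sum_effort (S := Finset.univ.filter fun e => C0 < Ce e - pa) hρ hx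
      fun e he => hV e (Finset.mem_filter.1 he).2
    have heq := effort_eq_of_sum_le hρ hx hV (le_of_mul_le_mul_left (by nlinarith) hpd)
    refine ⟨fun e he => by rw [heq, if_pos he], fun e he => by rw [heq, if_neg he], ?_⟩
    have h1 := hbr.1.2
    rw [Fintype.sum_option] at h1
    nlinarith
  · have hρ := h.1
    have hbr : IsBestResponse C0 Ce pa ρstar (σastar ρstar) := h.2.1 ρstar hρ
    have hval := h.attack_le hpa hT hvul
    rw [UdRho_eq C0 Ce pa pd] at hval
    have hx := hbr.residual_le
    have hM : C0 < UaRho C0 Ce pa ρstar (σastar ρstar) := by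
      refine hbr.le_UaRho.lt_of_ne fun hM => ?_
      rw [← hM] at hval hx
      simp only [rhoHat_eq] at hU
      have hP : 0 ≤ ∑ e, σastar ρstar (some e) := Finset.sum_nonneg fun e _ => hbr.1.1 _
      have hsum := sum_div_le_sum_effort (S := Finset.univ.filter fun e => C0 < Ce e - pa) hρ hx
        fun e he => hV e (Finset.mem_filter.1 he).2
      nlinarith
    have hone := hbr.sum_some_eq_one hM
    rw [hone] at hval
    have hxT : UaRho C0 Ce pa ρstar (σastar ρstar) + pa = T := by
      by_contra hne
      have := attack_cost_lt hpd hC0T hlt hgt hρ hx hne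
      linarith
    rw [hxT] at hx
    have heq := effort_eq_of_sum_le hρ hx hS (le_of_mul_le_mul_left (by linarith) hpd)
    exact ⟨fun e he => by rw [heq, if_pos he], fun e he => by rw [heq, if_neg he], hone⟩

end SecGame
end
end
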